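/- Let F : U × ⋯ × U → K be an n-linear form with n ≥ 3 over a field K, and let F = F₁ ⊕ ⋯ ⊕ F_s ⊕ 0 be a decomposition in which the summands F₁,…,F_s are nonzero and indecomposable, with corresponding decomposition U = U₁ ⊕ ⋯ ⊕ U_s ⊕ U₀. Then the summands F₁,…,F_s are determined by F uniquely up to congruence, and the sequence of subspaces U₁+U₀, …, U_s+U₀, U₀ is determined by F uniquely up to permutations of U₁+U₀,…,U_s+U₀: if F = G₁ ⊕ ⋯ ⊕ G_r ⊕ 0 is another such decomposition with corresponding U = V₁ ⊕ ⋯ ⊕ V_r ⊕ V₀, then r = s, V₀ = U₀, and there is a permutation π of {1,…,s} with V_i + V₀ = U_{π(i)} + U₀ and G_i congruent to F_{π(i)} for every i. -/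

import Mathlib

section Defs

variable {K : Type*} [Field K] {n : ℕ}

/-- The restriction of a multilinear form to a submodule. -/
def formRestrict {U : Type*} [AddCommGroup U] [Module K U]
    (F : MultilinearMap K (fun _ : Fin n => U) K) (W : Submodule K U) :
    MultilinearMap K (fun _ : Fin n => W) K :=
  F.compLinearMap fun _ => W.subtype

/-- Two multilinear forms are congruent if a single linear bijection carries one to the other. -/
def FormCongruent {U V : Type*} [AddCommGroup U] [Module K U] [AddCommGroup V] [Module K V]
    (F : MultilinearMap K (fun _ : Fin n => U) K)
    (G : MultilinearMap K (fun _ : Fin n => V) K) : Prop :=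
  ∃ φ : U ≃ₗ[K] V, ∀ u : Fin n → U, F u = G fun i => φ (u i)

/-- Symmetric equivalence of multilinear forms. -/
def FormSymmEquiv {U V : Type*} [AddCommGroup U] [Module K U] [AddCommGroup V] [Module K V]
    (F : MultilinearMap K (fun _ : Fin n => U) K)
    (G : MultilinearMap K (fun _ : Fin n => V) K) : Prop :=
  ∃ φ : Fin n → U ≃ₗ[K] V, ∀ (σ : Equiv.Perm (Fin n)) (u : Fin n → U),
    F u = G fun i => φ (σ i) (u i)

/-- `W` is a direct-sum decomposition of the underlying space for which `F` vanishes on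
mixed tuples, i.e. `F = ⨁ᵢ F|Wᵢ`. -/
def IsDecompFamily {U : Type*} [AddCommGroup U] [Module K U] {ι : Type*} [DecidableEq ι]
    (F : MultilinearMap K (fun _ : Fin n => U) K) (W : ι → Submodule K U) : Prop :=
  DirectSum.IsInternal W ∧
    ∀ (x : Fin n → U) (k l : Fin n) (i j : ι), i ≠ j → x k ∈ W i → x l ∈ W j → F x = 0

/-- A multilinear form is indecomposable if in every direct-sum decomposition one of the
two subspaces is zero. -/
def FormIndecomposable {U : Type*} [AddCommGroup U] [Module K U]
    (F : MultilinearMap K (fun _ : Fin n => U) K) : Prop :=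
  ∀ W₁ W₂ : Submodule K U, IsCompl W₁ W₂ →
    (∀ (x : Fin n → U) (k l : Fin n), x k ∈ W₁ → x l ∈ W₂ → F x = 0) →
    W₁ = ⊥ ∨ W₂ = ⊥

/-- A multilinear form has no zero direct summands if in every direct-sum decomposition the
summand that is the zero form corresponds to the zero subspace. -/
def FormNoZeroSummand {U : Type*} [AddCommGroup U] [Module K U]
    (F : MultilinearMap K (fun _ : Fin n => U) K) : Prop :=
  ∀ W₁ W₂ : Submodule K U, IsCompl W₁ W₂ →
    (∀ (x : Fin n → U) (k l : Fin n), x k ∈ W₁ → x l ∈ W₂ → F x = 0) →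
    (∀ x : Fin n → U, (∀ k, x k ∈ W₂) → F x = 0) → W₂ = ⊥

/-- A linear map `τ` is `G`-selfadjoint if applying `τ` in any one argument of `G`
gives the same value regardless of the argument chosen. -/
def FormSelfAdjoint {V : Type*} [AddCommGroup V] [Module K V]
    (G : MultilinearMap K (fun _ : Fin n => V) K) (τ : V →ₗ[K] V) : Prop :=
  ∀ (v : Fin n → V) (i j : Fin n),
    G (Function.update v i (τ (v i))) = G (Function.update v j (τ (v j)))

end Defs

/-- `F` vanishes on every tuple having one entry in `A` and one entry in `B`. -/
def FormOrthogonal {K : Type*} [Field K] {n : ℕ} {U : Type*} [AddCommGroup U] [Module K U]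
    (F : MultilinearMap K (fun _ : Fin n => U) K) (A B : Submodule K U) : Prop :=
  ∀ (x : Fin n → U) (k l : Fin n), x k ∈ A → x l ∈ B → F x = 0

/-- The radical of a multilinear form: the vectors on which the form vanishes, whatever
argument they are placed in. -/
def formRadical {K : Type*} [Field K] {n : ℕ} {U : Type*} [AddCommGroup U] [Module K U]
    (F : MultilinearMap K (fun _ : Fin n => U) K) : Submodule K U :=
  ⨅ (k : Fin n) (x : Fin n → U), LinearMap.ker (F.toLinearMap x k)

/-- `p` is the projection onto `A` along `B`. -/
structure IsProjAlong {K : Type*} [Field K] {U : Type*} [AddCommGroup U] [Module K U]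
    (p : U →ₗ[K] U) (A B : Submodule K U) : Prop where
  mem (u : U) : p u ∈ A
  sub_mem (u : U) : u - p u ∈ B
  of_mem_left {a : U} : a ∈ A → p a = a
  of_mem_right {b : U} : b ∈ B → p b = 0

section FormDecomposition

variable {K : Type*} [Field K] {n : ℕ} {U : Type*} [AddCommGroup U] [Module K U]
  {F : MultilinearMap K (fun _ : Fin n => U) K}

theorem exists_isProjAlong {A B : Submodule K U} (h : IsCompl A B) :
    ∃ p : U →ₗ[K] U, IsProjAlong p A B := by
  refine ⟨A.projection B h, fun u => Submodule.projection_apply_mem h u, fun u => ?_,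
    fun {a} ha => Submodule.projection_apply_left h ⟨a, ha⟩,
    fun {b} hb => Submodule.projection_apply_right h ⟨b, hb⟩⟩
  rw [← Submodule.projection_apply_eq_zero_iff h, map_sub,
    Submodule.projection_apply_left h ⟨_, Submodule.projection_apply_mem h u⟩, sub_self]

theorem mem_formRadical_iff {u : U} :
    u ∈ formRadical F ↔ ∀ (k : Fin n) (x : Fin n → U), F (Function.update x k u) = 0 := by
  simp [formRadical]

theorem map_eq_zero_of_mem_formRadical {x : Fin n → U} {k : Fin n}
    (h : x k ∈ formRadical F) : F x = 0 := by
  simpa using mem_formRadical_iff.1 h k x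

theorem formRestrict_eq_zero_of_mem_formRadical {C : Submodule K U} {x : Fin n → C} {k : Fin n}
    (h : (x k : U) ∈ formRadical F) : formRestrict F C x = 0 :=
  map_eq_zero_of_mem_formRadical (x := fun i => (x i : U)) h

theorem map_update_eq_of_sub_mem_formRadical (x : Fin n → U) (k : Fin n) {u v : U}
    (h : u - v ∈ formRadical F) : F (Function.update x k u) = F (Function.update x k v) := by
  rw [← sub_eq_zero, ← F.map_update_sub]
  exact mem_formRadical_iff.1 h k x

theorem map_eq_of_sub_mem_formRadical {x y : Fin n → U}
    (h : ∀ k, x k - y k ∈ formRadical F) : F x = F y := by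
  suffices H : ∀ S : Finset (Fin n), F x = F fun k => if k ∈ S then y k else x k by
    simpa using H Finset.univ
  intro S
  induction S using Finset.induction_on with
  | empty => simp
  | insert a S ha ih =>
    rw [ih]
    have e : (fun k => if k ∈ S then y k else x k) =
        Function.update (fun k => if k ∈ S then y k else x k) a (x a) := by
      rw [eq_comm, Function.update_eq_self_iff]; simp [ha]
    rw [e, map_update_eq_of_sub_mem_formRadical _ _ (h a)]
    congr 1
    ext k
    by_cases hk : k = a
    · subst hk; simp
    · simp [hk]

namespace IsProjAlong

variable {A B : Submodule K U} {p : U →ₗ[K] U}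

theorem map_update_of_mem (hp : IsProjAlong p A B) (hAB : FormOrthogonal F A B) {x : Fin n → U}
    {k l : Fin n} (hx : x k ∈ A) : F x = F (Function.update x l (p (x l))) := by
  by_cases hkl : l = k
  · subst hkl; simp [hp.of_mem_left hx]
  rw [← sub_eq_zero]
  nth_rw 1 [← Function.update_eq_self l x]
  rw [← F.map_update_sub]
  exact hAB _ k l (by simpa [Ne.symm hkl] using hx) (by simpa using hp.sub_mem (x l))

theorem formSelfAdjoint (hp : IsProjAlong p A B) (hAB : FormOrthogonal F A B) :
    FormSelfAdjoint F p := by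
  intro v i j
  by_cases hij : i = j
  · rw [hij]
  rw [hp.map_update_of_mem hAB (k := i) (l := j) (by simpa using hp.mem (v i)),
    hp.map_update_of_mem (x := Function.update v j (p (v j))) hAB (k := j) (l := i)
      (by simpa using hp.mem (v j))]
  rw [Function.update_of_ne (Ne.symm hij), Function.update_of_ne hij, Function.update_comm hij]

end IsProjAlong

theorem FormSelfAdjoint.map_update {τ : U →ₗ[K] U} (h : FormSelfAdjoint F τ) (x : Fin n → U)
    {k l : Fin n} (hkl : k ≠ l) (u : U) :
    F (Function.update x k (τ u)) = F (Function.update (Function.update x k u) l (τ (x l))) := by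
  have := h (Function.update x k u) k l
  simpa [hkl.symm] using this

theorem FormSelfAdjoint.apply_mem_formRadical (hn : 2 ≤ n) {τ : U →ₗ[K] U}
    (h : FormSelfAdjoint F τ) {u : U} (hu : u ∈ formRadical F) : τ u ∈ formRadical F := by
  rw [mem_formRadical_iff]
  intro k x
  have : Nontrivial (Fin n) := Fin.nontrivial_iff_two_le.2 hn
  obtain ⟨l, hl⟩ := exists_ne k
  rw [h.map_update x hl.symm]
  exact map_eq_zero_of_mem_formRadical (k := k) (by simpa [hl.symm] using hu)

/-- Selfadjoint operators of a form in at least three arguments commute modulo the radical. -/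
theorem FormSelfAdjoint.commute_mod_formRadical (hn : 3 ≤ n) {σ τ : U →ₗ[K] U}
    (hσ : FormSelfAdjoint F σ) (hτ : FormSelfAdjoint F τ) (u : U) :
    σ (τ u) - τ (σ u) ∈ formRadical F := by
  rw [mem_formRadical_iff]
  intro k x
  rw [F.map_update_sub, sub_eq_zero]
  obtain ⟨l, m, hkl, hkm, hlm⟩ : ∃ l m : Fin n, k ≠ l ∧ k ≠ m ∧ l ≠ m := by
    have hc : 1 < ((Finset.univ : Finset (Fin n)).erase k).card := by
      rw [Finset.card_erase_of_mem (Finset.mem_univ k), Finset.card_univ, Fintype.card_fin]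
      omega
    obtain ⟨l, hl, m, hm, hlm⟩ := Finset.one_lt_card.1 hc
    exact ⟨l, m, (Finset.ne_of_mem_erase hl).symm, (Finset.ne_of_mem_erase hm).symm, hlm⟩
  have h₁ := hσ.map_update x hkl (τ u)
  have h₂ := hτ.map_update x hkm (σ u)
  rw [Function.update_comm hkl] at h₁
  rw [Function.update_comm hkm] at h₂
  rw [h₁, h₂, hτ.map_update _ hkm, hσ.map_update _ hkl]
  congr 1
  ext i
  by_cases h1 : i = k <;> by_cases h2 : i = l <;> by_cases h3 : i = m <;>
    simp_all [Function.update_apply]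

/-- Two orthogonal decompositions `A ⊕ B` and `C ⊕ D`, where `C` carries an indecomposable
form, are compatible modulo the radical. -/
theorem le_or_le_sup_formRadical (hn : 3 ≤ n) {A B C D : Submodule K U}
    (hAB : IsCompl A B) (hCD : IsCompl C D)
    (hFAB : FormOrthogonal F A B) (hFCD : FormOrthogonal F C D)
    (hB : formRadical F ≤ B)
    (hC : FormIndecomposable (formRestrict F C)) :
    C ≤ B ∨ C ≤ A ⊔ formRadical F := by
  obtain ⟨p, hp⟩ := exists_isProjAlong hAB
  obtain ⟨q, hq⟩ := exists_isProjAlong hCD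
  have hpq := (hp.formSelfAdjoint hFAB).commute_mod_formRadical hn (hq.formSelfAdjoint hFCD)
  have key : ∀ c ∈ C, p c - q (p c) ∈ formRadical F := fun c hc => by
    simpa [hq.of_mem_left hc] using hpq c
  let e : C →ₗ[K] C := (q ∘ₗ p ∘ₗ C.subtype).codRestrict C fun c => hq.mem _
  have he : ∀ c : C, (e c : U) = q (p c) := fun c => rfl
  have hid : IsIdempotentElem e := by
    ext c
    change q (p (q (p c))) = q (p c)
    have h0 := hp.of_mem_right (hB (key c c.2))
    rw [map_sub, sub_eq_zero, hp.of_mem_left (hp.mem _)] at h0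
    rw [← h0]
  have horth : ∀ (x : Fin n → C) (k l : Fin n), x k ∈ LinearMap.range e →
      x l ∈ LinearMap.ker e → formRestrict F C x = 0 := by
    intro x k l hk hl
    by_cases hkl : k = l
    · subst hkl
      have h0 : x k = 0 := (Submodule.disjoint_def.1
        (LinearMap.IsIdempotentElem.isCompl hid).disjoint) _ hk hl
      exact (formRestrict F C).map_coord_zero k h0
    obtain ⟨y, hy⟩ := hk
    have hyk : (x k : U) = q (p y) := by rw [← hy, he]
    have hl' : q (p (x l)) = 0 := by rw [← he, LinearMap.mem_ker.1 hl]; rfl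
    change F (fun i => (x i : U)) = 0
    rw [← Function.update_eq_self k (fun i => (x i : U)), hyk,
      ← map_update_eq_of_sub_mem_formRadical _ k (key y y.2),
      (hp.formSelfAdjoint hFAB).map_update _ hkl]
    refine map_eq_zero_of_mem_formRadical (k := l) ?_
    simpa [hl'] using key (x l) (x l).2
  rcases hC _ _ (LinearMap.IsIdempotentElem.isCompl hid) horth with h | h
  · left
    intro c hc
    have h0 : q (p c) = 0 := by
      have := LinearMap.range_eq_bot.1 h
      rw [← he ⟨c, hc⟩, this]; rfl
    have h1 : p c = 0 := by
      have h2 := key c hc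
      rw [h0, sub_zero] at h2
      exact Submodule.disjoint_def.1 hAB.disjoint _ (hp.mem c) (hB h2)
    simpa [h1] using hp.sub_mem c
  · right
    intro c hc
    have h0 : q (p c) = c := by
      have h1 : e ⟨c, hc⟩ = ⟨c, hc⟩ :=
        LinearMap.ker_eq_bot.1 h (by rw [← Module.End.mul_apply, hid.eq])
      rw [← he ⟨c, hc⟩, h1]
    have h2 := key c hc
    rw [h0] at h2
    rw [show c = p c + -(p c - c) by abel]
    exact Submodule.add_mem_sup (hp.mem c) (neg_mem h2)

section Family

variable {ι : Type*} [DecidableEq ι] {W : ι → Submodule K U}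

theorem IsDecompFamily.isCompl (h : IsDecompFamily F W) (i : ι) :
    IsCompl (W i) (⨆ (j) (_ : j ≠ i), W j) := by
  refine ⟨h.1.submodule_iSupIndep i, codisjoint_iff.2 ?_⟩
  rw [← h.1.submodule_iSup_eq_top]
  exact (iSup_split_single W i).symm

theorem IsDecompFamily.formOrthogonal (h : IsDecompFamily F W) (i : ι) :
    FormOrthogonal F (W i) (⨆ (j) (_ : j ≠ i), W j) := by
  intro x k l hk hl
  by_cases hkl : k = l
  · subst hkl
    exact F.map_coord_zero k (Submodule.disjoint_def.1 (h.isCompl i).disjoint _ hk hl)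
  have hle : (⨆ (j) (_ : j ≠ i), W j) ≤ LinearMap.ker (F.toLinearMap x l) :=
    iSup₂_le fun j hj w hw =>
      h.2 (Function.update x l w) k l i j hj.symm (by simpa [hkl] using hk) (by simpa using hw)
  simpa using hle hl

theorem IsDecompFamily.mem_of_forall_ne (h : IsDecompFamily F W) {i : ι} {u : U}
    (hu : ∀ j, j ≠ i → u ∈ ⨆ (l) (_ : l ≠ j), W l) : u ∈ W i := by
  obtain ⟨f, hf, hfu⟩ := (Submodule.mem_iSup_iff_exists_finsupp W u).1
    (h.1.submodule_iSup_eq_top ▸ Submodule.mem_top)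
  rw [← hfu]
  refine Submodule.sum_mem _ fun j hj => ?_
  by_cases hji : j = i
  · exact hji ▸ hf j
  have hrest : ∑ l ∈ f.support.erase j, f l ∈ ⨆ (l) (_ : l ≠ j), W l :=
    Submodule.sum_mem _ fun l hl =>
      Submodule.mem_iSup_of_mem l
        (Submodule.mem_iSup_of_mem (Finset.ne_of_mem_erase hl) (hf l))
  have hsum : f j = u - ∑ l ∈ f.support.erase j, f l := by
    rw [← hfu, Finsupp.sum, ← Finset.add_sum_erase _ _ hj, add_sub_cancel_right]
  have h0 : f j = 0 := Submodule.disjoint_def.1 (h.isCompl j).disjoint _ (hf j)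
    (hsum ▸ sub_mem (hu j hji) hrest)
  simp [h0]

end Family

theorem inf_formRadical_eq_bot (hn : 1 ≤ n) {C : Submodule K U}
    (hC : FormIndecomposable (formRestrict F C)) (hnz : formRestrict F C ≠ 0) :
    C ⊓ formRadical F = ⊥ := by
  obtain ⟨E, hE⟩ := Submodule.exists_isCompl ((formRadical F).comap C.subtype)
  rcases hC _ _ hE fun x k l hk _ => formRestrict_eq_zero_of_mem_formRadical (k := k) hk with h | h
  · rwa [← Submodule.disjoint_iff_comap_eq_bot, disjoint_iff] at h
  · refine absurd (MultilinearMap.ext fun x => ?_) hnz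
    have htop := hE.sup_eq_top
    rw [h, sup_bot_eq] at htop
    exact formRestrict_eq_zero_of_mem_formRadical (k := ⟨0, hn⟩)
      (htop ▸ Submodule.mem_top : x ⟨0, hn⟩ ∈ (formRadical F).comap C.subtype)

section OptionFamily

variable {s : ℕ} {Us : Fin s → Submodule K U} {U₀ : Submodule K U}

theorem IsDecompFamily.eq_formRadical (hn : 2 ≤ n)
    (h : IsDecompFamily F (fun o : Option (Fin s) => o.elim U₀ Us))
    (h0 : ∀ x : Fin n → U, (∀ k, x k ∈ U₀) → F x = 0)
    (hnz : ∀ i, formRestrict F (Us i) ≠ 0)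
    (hind : ∀ i, FormIndecomposable (formRestrict F (Us i))) :
    U₀ = formRadical F := by
  apply le_antisymm
  · intro u hu
    obtain ⟨p, hp⟩ := exists_isProjAlong (h.isCompl none)
    have horth := h.formOrthogonal none
    rw [mem_formRadical_iff]
    intro k x
    have hk : Function.update x k u k ∈ U₀ := by simpa using hu
    suffices H : ∀ S : Finset (Fin n), F (Function.update x k u) =
        F fun l => if l ∈ S then p (Function.update x k u l) else Function.update x k u l by
      rw [H Finset.univ]
      exact h0 _ fun l => by simpa using hp.mem _
    intro S
    induction S using Finset.induction_on with
    | empty => simp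
    | insert a S ha ih =>
      rw [ih, hp.map_update_of_mem horth (k := k) (l := a)]
      · congr 1
        ext l
        by_cases hl : l = a
        · subst hl; simp [ha]
        · simp [hl]
      · by_cases hkS : k ∈ S
        · simpa [hkS] using hp.mem u
        · simpa [hkS] using hu
  · intro u hu
    refine h.mem_of_forall_ne (i := none) fun j hj => ?_
    obtain ⟨i, rfl⟩ := Option.ne_none_iff_exists'.1 hj
    obtain ⟨p, hp⟩ := exists_isProjAlong (h.isCompl (some i))
    have hmem := (hp.formSelfAdjoint (h.formOrthogonal (some i))).apply_mem_formRadical hn hu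
    have hpu : p u ∈ Us i ⊓ formRadical F := ⟨hp.mem u, hmem⟩
    rw [inf_formRadical_eq_bot (by omega) (hind i) (hnz i), Submodule.mem_bot] at hpu
    simpa [hpu] using hp.sub_mem u

theorem le_iSup_ne_some (i : Fin s) :
    U₀ ≤ ⨆ (j) (_ : j ≠ some i), (fun o : Option (Fin s) => o.elim U₀ Us) j :=
  le_iSup₂_of_le none (by simp) le_rfl

/-- An indecomposable nonzero summand is contained, modulo the radical, in some summand of any
other decomposition. -/
theorem IsDecompFamily.exists_le_sup (hn : 3 ≤ n)
    (h : IsDecompFamily F (fun o : Option (Fin s) => o.elim U₀ Us)) (hU₀ : U₀ = formRadical F)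
    {C D : Submodule K U} (hCD : IsCompl C D) (hFCD : FormOrthogonal F C D)
    (hnz : formRestrict F C ≠ 0)
    (hC : FormIndecomposable (formRestrict F C)) :
    ∃ i, C ≤ Us i ⊔ U₀ := by
  by_contra! hcon
  have hle : C ≤ U₀ := fun c hc => h.mem_of_forall_ne (i := none) fun j hj => by
    obtain ⟨i, rfl⟩ := Option.ne_none_iff_exists'.1 hj
    have hor := le_or_le_sup_formRadical hn (h.isCompl (some i)) hCD (h.formOrthogonal (some i))
      hFCD (hU₀ ▸ le_iSup_ne_some i) hC
    rw [← hU₀] at hor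
    exact hor.resolve_right (hcon i) hc
  refine hnz (MultilinearMap.ext fun x => ?_)
  exact formRestrict_eq_zero_of_mem_formRadical (k := ⟨0, by omega⟩) (hU₀ ▸ hle (x _).2)

theorem IsDecompFamily.eq_of_le_sup
    (h : IsDecompFamily F (fun o : Option (Fin s) => o.elim U₀ Us)) {i j : Fin s}
    (hi : Us i ≠ ⊥) (hij : Us i ≤ Us j ⊔ U₀) : i = j := by
  by_contra hne
  refine hi ((h.isCompl (some i)).disjoint.eq_bot_of_le (hij.trans (sup_le ?_ ?_)))
  · exact le_iSup₂_of_le (some j) (by simpa using Ne.symm hne) le_rfl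
  · exact le_iSup_ne_some i

end OptionFamily

theorem formCongruent_of_sup_formRadical_eq {A C : Submodule K U}
    (hA : Disjoint A (formRadical F)) (hC : Disjoint C (formRadical F))
    (h : C ⊔ formRadical F = A ⊔ formRadical F) :
    FormCongruent (formRestrict F C) (formRestrict F A) := by
  have hex : ∀ c : C, ∃ a : A, (c : U) - a ∈ formRadical F := fun c => by
    obtain ⟨a, ha, z, hz, hc⟩ := Submodule.mem_sup.1 (h ▸ Submodule.mem_sup_left c.2)
    exact ⟨⟨a, ha⟩, by simpa [← hc] using hz⟩
  have hex' : ∀ a : A, ∃ c : C, (c : U) - a ∈ formRadical F := fun a => by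
    obtain ⟨c, hc, z, hz, ha⟩ := Submodule.mem_sup.1 (h ▸ Submodule.mem_sup_left a.2)
    exact ⟨⟨c, hc⟩, by simpa [← ha] using hz⟩
  have huniq : ∀ {X : Submodule K U}, Disjoint X (formRadical F) → ∀ a b : X,
      (a : U) - b ∈ formRadical F → a = b := fun hX a b hab => by
    have := Submodule.disjoint_def.1 hX _ (sub_mem a.2 b.2) hab
    exact Subtype.ext (sub_eq_zero.1 this)
  choose f hf using hex
  let φ : C →ₗ[K] A :=
    { toFun := f
      map_add' := fun c d => huniq hA _ _ (by
        have := sub_mem (add_mem (hf c) (hf d)) (hf (c + d))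
        convert this using 1
        push_cast
        abel)
      map_smul' := fun t c => huniq hA _ _ (by
        have := sub_mem (Submodule.smul_mem _ t (hf c)) (hf (t • c))
        convert this using 1
        simp [smul_sub]) }
  have hφ : ∀ c : C, (c : U) - φ c ∈ formRadical F := hf
  have hbij : Function.Bijective φ := by
    refine ⟨fun c d hcd => huniq hC _ _ ?_, fun a => ?_⟩
    · have := sub_mem (hφ c) (hφ d)
      rw [hcd] at this
      simpa using this
    · obtain ⟨c, hc⟩ := hex' a
      exact ⟨c, huniq hA _ _ (by simpa using sub_mem hc (hφ c))⟩
  exact ⟨LinearEquiv.ofBijective φ hbij, fun u =>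
    map_eq_of_sub_mem_formRadical fun k => hφ (u k)⟩

end FormDecomposition

/-- Corollary: an `n`-linear form (`n ≥ 3`) decomposes into a direct sum of nonzero
indecomposable forms plus a zero form uniquely: the summands are determined up to congruence
and the subspaces `U₁ + U₀, …, U_s + U₀, U₀` are determined up to a permutation of the first
`s` of them. -/
theorem stmt_13 {K : Type*} [Field K] {n : ℕ} (hn : 3 ≤ n)
    {U : Type*} [AddCommGroup U] [Module K U] [FiniteDimensional K U]
    (F : MultilinearMap K (fun _ : Fin n => U) K)
    {s r : ℕ}
    (Us : Fin s → Submodule K U) (U₀ : Submodule K U)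
    (Vs : Fin r → Submodule K U) (V₀ : Submodule K U)
    -- F = F₁ ⊕ ⋯ ⊕ F_s ⊕ 0 with respect to U = U₁ ⊕ ⋯ ⊕ U_s ⊕ U₀
    (hUdec : IsDecompFamily F (fun o : Option (Fin s) => o.elim U₀ Us))
    (hU0 : ∀ x : Fin n → U, (∀ k, x k ∈ U₀) → F x = 0)
    (hUnz : ∀ i, formRestrict F (Us i) ≠ 0)
    (hUind : ∀ i, FormIndecomposable (formRestrict F (Us i)))
    -- F = G₁ ⊕ ⋯ ⊕ G_r ⊕ 0 with respect to U = V₁ ⊕ ⋯ ⊕ V_r ⊕ V₀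
    (hVdec : IsDecompFamily F (fun o : Option (Fin r) => o.elim V₀ Vs))
    (hV0 : ∀ x : Fin n → U, (∀ k, x k ∈ V₀) → F x = 0)
    (hVnz : ∀ j, formRestrict F (Vs j) ≠ 0)
    (hVind : ∀ j, FormIndecomposable (formRestrict F (Vs j))) :
    r = s ∧ V₀ = U₀ ∧ ∃ π : Fin r ≃ Fin s, ∀ i : Fin r,
      Vs i ⊔ V₀ = Us (π i) ⊔ U₀ ∧
      FormCongruent (formRestrict F (Vs i)) (formRestrict F (Us (π i))) := by
  have hUrad := hUdec.eq_formRadical (by omega) hU0 hUnz hUind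
  have hVrad := hVdec.eq_formRadical (by omega) hV0 hVnz hVind
  have hUV : V₀ = U₀ := hVrad.trans hUrad.symm
  have hne : ∀ {C : Submodule K U}, formRestrict F C ≠ 0 → C ≠ ⊥ := by
    rintro C hC rfl
    exact hC (MultilinearMap.ext fun x =>
      (formRestrict F ⊥).map_coord_zero ⟨0, by omega⟩ (Subsingleton.elim _ _))
  have hVU : ∀ j, ∃ i, Vs j ≤ Us i ⊔ U₀ := fun j =>
    hUdec.exists_le_sup hn hUrad (hVdec.isCompl (some j)) (hVdec.formOrthogonal (some j))
      (hVnz j) (hVind j)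
  have hUV' : ∀ i, ∃ j, Us i ≤ Vs j ⊔ V₀ := fun i =>
    hVdec.exists_le_sup hn hVrad (hUdec.isCompl (some i)) (hUdec.formOrthogonal (some i))
      (hUnz i) (hUind i)
  choose f hf using hVU
  choose g hg using hUV'
  rw [hUV] at hVdec hg
  have hgf : ∀ j, g (f j) = j := fun j => (hVdec.eq_of_le_sup (hne (hVnz j))
    ((hf j).trans (sup_le (hg (f j)) le_sup_right))).symm
  have hfg : ∀ i, f (g i) = i := fun i => (hUdec.eq_of_le_sup (hne (hUnz i))
    ((hg i).trans (sup_le (hf (g i)) le_sup_right))).symm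
  let π : Fin r ≃ Fin s := ⟨f, g, hgf, hfg⟩
  have hsup : ∀ j, Vs j ⊔ U₀ = Us (π j) ⊔ U₀ := fun j => by
    refine le_antisymm (sup_le (hf j) le_sup_right) (sup_le ?_ le_sup_right)
    have := hg (f j)
    rwa [hgf] at this
  refine ⟨Fin.equiv_iff_eq.1 ⟨π⟩, hUV, π, fun j => ⟨hUV ▸ hsup j, ?_⟩⟩
  refine formCongruent_of_sup_formRadical_eq ?_ ?_ (hUrad ▸ hsup j)
  · exact disjoint_iff.2 (inf_formRadical_eq_bot (by omega) (hUind _) (hUnz _))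
  · exact disjoint_iff.2 (inf_formRadical_eq_bot (by omega) (hVind _) (hVnz _))
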